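/- Eigenvalue characterization. A complex number λ is an eigenvalue of the Sturm–Liouville problem (σ² y')' = λ y on (0,1) with y(0) = y(1) = 0 — that is, there exists a function y : [0,1] → ℂ, not identically zero, such that y and x ↦ σ(x)² y'(x) are absolutely continuous, (σ(x)² y'(x))' = λ y(x) for almost every x ∈ (0,1), and y(0) = y(1) = 0 — if and only if λ is a negative real number and Δ(√(−λ)) = 0. -/

import Mathlib

open MeasureTheory Filter

noncomputable section

/-- Nodes of the simplex: `y₀ = a`, `y_{n+1} = b`, interior nodes from `y`. -/
def nodes (a b : ℝ) (n : ℕ) (y : Fin n → ℝ) (p : ℕ) : ℝ :=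
  if h : 1 ≤ p ∧ p ≤ n then y ⟨p - 1, by omega⟩ else if p = 0 then a else b

/-- The ordered simplex `a ≤ y₁ ≤ ⋯ ≤ y_n ≤ b`. -/
def simplex (a b : ℝ) (n : ℕ) : Set (Fin n → ℝ) :=
  {y | Monotone y ∧ ∀ i, y i ∈ Set.Icc a b}

/-- The alternating phase `∑_{p=0}^{n} (−1)^p ∫_{y_p}^{y_{p+1}} dξ/σ(ξ)`. -/
def phase (σ : ℝ → ℝ) (a b : ℝ) (n : ℕ) (y : Fin n → ℝ) : ℝ :=
  ∑ p ∈ Finset.range (n + 1),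
    (-1 : ℝ) ^ p * ∫ ξ in (nodes a b n y p)..(nodes a b n y (p + 1)), 1 / σ ξ

/-- The integrand defining `S_n^{(a,b)}(k)`. -/
def Sintegrand (σ : ℝ → ℝ) (a b : ℝ) (n : ℕ) (k : ℂ) (y : Fin n → ℝ) : ℂ :=
  ((∏ p, deriv σ (y p) / σ (y p) : ℝ) : ℂ) * Complex.sin (k * ((phase σ a b n y : ℝ) : ℂ))

/-- `S_n^{(a,b)}(k)`. -/
def S (σ : ℝ → ℝ) (a b : ℝ) (n : ℕ) (k : ℂ) : ℂ :=
  ((2 : ℂ) ^ n)⁻¹ * ∫ y in simplex a b n, Sintegrand σ a b n k y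

/-- `Δ(k) = ∑_{n=0}^∞ S_n^{(0,1)}(k)`. -/
def Δfun (σ : ℝ → ℝ) (k : ℂ) : ℂ := ∑' n, S σ 0 1 n k

/-- `σ` is absolutely continuous on `[0,1]`: fundamental-theorem-of-calculus
characterization with integrable derivative. -/
def sigmaAC (σ : ℝ → ℝ) : Prop :=
  IntegrableOn (deriv σ) (Set.Icc 0 1) ∧
    ∀ x ∈ Set.Icc (0 : ℝ) 1, σ x = σ 0 + ∫ t in (0 : ℝ)..x, deriv σ t

/-- Absolute continuity of a complex-valued function on `[a,b]`:
FTC characterization with integrable density. -/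
def ACOn (f : ℝ → ℂ) (a b : ℝ) : Prop :=
  ∃ g : ℝ → ℂ, IntegrableOn g (Set.Icc a b) ∧ ∀ x ∈ Set.Icc a b, f x = f a + ∫ t in a..x, g t

theorem measurableSet_simplex (a b : ℝ) (n : ℕ) : MeasurableSet (simplex a b n) := by
  have h : simplex a b n = {y | Monotone y} ∩ Set.Icc (fun _ => a) (fun _ => b) := by
    ext y
    simp only [simplex, Set.mem_ofPred_eq, Set.mem_inter_iff, Set.mem_Icc, Pi.le_def, forall_and]
  rw [h]
  refine (IsClosed.inter ?_ isClosed_Icc).measurableSet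
  have : {y : Fin n → ℝ | Monotone y} = ⋂ (i) (j) (_ : i ≤ j), {y | y i ≤ y j} := by
    ext y
    simp [Monotone]
  rw [this]
  exact isClosed_iInter fun i => isClosed_iInter fun j => isClosed_iInter fun _ =>
    isClosed_le (continuous_apply i) (continuous_apply j)

theorem snoc_mem_simplex {a b : ℝ} {n : ℕ} (t : ℝ) (y : Fin n → ℝ) :
    (Fin.snoc y t : Fin (n + 1) → ℝ) ∈ simplex a b (n + 1) ↔
      t ∈ Set.Icc a b ∧ y ∈ simplex a t n := by
  constructor
  · rintro ⟨hm, hI⟩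
    refine ⟨by simpa using hI (Fin.last n), fun i j hij => ?_, fun i => ⟨?_, ?_⟩⟩
    · simpa using hm (Fin.castSucc_le_castSucc_iff.2 hij)
    · simpa using (hI i.castSucc).1
    · simpa using hm (Fin.le_last i.castSucc)
  · rintro ⟨ht, hm, hI⟩
    refine ⟨fun i j hij => ?_, fun i => ?_⟩
    · induction j using Fin.lastCases with
      | last =>
        induction i using Fin.lastCases with
        | last => exact le_rfl
        | cast i => simpa using (hI i).2
      | cast j =>
        induction i using Fin.lastCases with
        | last => exact absurd hij (not_le.2 (Fin.castSucc_lt_last j))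
        | cast i => simpa using hm (Fin.castSucc_le_castSucc_iff.1 hij)
    · induction i using Fin.lastCases with
      | last => simpa using ht
      | cast i => simpa using ⟨(hI i).1, (hI i).2.trans ht.2⟩

/-- The iterated integral of `f 0 ⊗ ⋯ ⊗ f (n - 1)` over the ordered simplex in `[a, b]`. -/
def simplexIntegral (f : ℕ → ℝ → ℂ) (a b : ℝ) (n : ℕ) : ℂ :=
  ∫ y in simplex a b n, ∏ p : Fin n, f p (y p)

theorem simplexIntegral_zero (f : ℕ → ℝ → ℂ) (a b : ℝ) : simplexIntegral f a b 0 = 1 := by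
  have : simplex a b 0 = Set.univ := by
    ext y
    simp [simplex, Monotone]
  simp [simplexIntegral, this, Measure.real, volume_pi]

theorem simplexIntegral_succ {f : ℕ → ℝ → ℂ} (hf : ∀ p, Integrable (f p)) (a b : ℝ) (n : ℕ) :
    simplexIntegral f a b (n + 1) = ∫ t in Set.Icc a b, f n t * simplexIntegral f a t n := by
  set e := MeasurableEquiv.piFinSuccAbove (fun _ : Fin (n + 1) => ℝ) (Fin.last n) with he
  have hpres := (volume_preserving_piFinSuccAbove (fun _ : Fin (n + 1) => ℝ) (Fin.last n)).symm
  have hsymm (z : ℝ × (Fin n → ℝ)) : e.symm z = (Fin.snoc z.2 z.1 : Fin (n + 1) → ℝ) := by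
    simp [he, MeasurableEquiv.piFinSuccAbove, Fin.insertNthEquiv]
  set F : (Fin (n + 1) → ℝ) → ℂ :=
    (simplex a b (n + 1)).indicator fun y => ∏ p : Fin (n + 1), f p (y p) with hF
  have hFint : Integrable F :=
    (Integrable.fintype_prod (fun p : Fin (n + 1) => hf p)).indicator
      (measurableSet_simplex a b (n + 1))
  have hGint : Integrable (fun z => F (e.symm z)) :=
    (hpres.integrable_comp_emb e.symm.measurableEmbedding).2 hFint
  have hval (t : ℝ) (y : Fin n → ℝ) : F (e.symm (t, y)) =
      (Set.Icc a b).indicator (fun t => f n t *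
        (simplex a t n).indicator (fun y => ∏ p : Fin n, f p (y p)) y) t := by
    rw [hsymm, hF]
    by_cases ht : t ∈ Set.Icc a b <;> by_cases hy : y ∈ simplex a t n <;>
      simp [Set.indicator, snoc_mem_simplex, ht, hy, Fin.prod_univ_castSucc, mul_comm]
  calc simplexIntegral f a b (n + 1) = ∫ y, F y := by
        rw [simplexIntegral, hF, integral_indicator (measurableSet_simplex a b (n + 1))]
    _ = ∫ z, F (e.symm z) := (hpres.integral_comp e.symm.measurableEmbedding F).symm
    _ = ∫ t, ∫ y, F (e.symm (t, y)) := by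
        rw [Measure.volume_eq_prod] at hGint ⊢
        exact integral_prod _ hGint
    _ = _ := by
        rw [← integral_indicator measurableSet_Icc]
        refine integral_congr_ae (.of_forall fun t => ?_)
        simp only [hval]
        by_cases ht : t ∈ Set.Icc a b
        · simp only [Set.indicator_of_mem ht, integral_const_mul, simplexIntegral,
            integral_indicator (measurableSet_simplex a t n)]
        · simp [Set.indicator_of_notMem ht]

theorem AbsolutelyContinuousOnInterval.of_dist_le {X Z : Type*} [PseudoMetricSpace X]
    [PseudoMetricSpace Z] {f : ℝ → X} {g : ℝ → Z} {a b : ℝ} (C : ℝ)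
    (hg : AbsolutelyContinuousOnInterval g a b)
    (h : ∀ x ∈ Set.uIcc a b, ∀ y ∈ Set.uIcc a b, dist (f x) (f y) ≤ C * dist (g x) (g y)) :
    AbsolutelyContinuousOnInterval f a b := by
  have h0 := Tendsto.const_mul C hg
  rw [mul_zero] at h0
  refine squeeze_zero' (.of_forall fun E => Finset.sum_nonneg fun i _ => dist_nonneg) ?_ h0
  filter_upwards [mem_inf_of_right (mem_principal_self _)] with E hE
  rw [Finset.mul_sum]
  exact Finset.sum_le_sum fun i hi => h _ (hE.1 i hi).1 _ (hE.1 i hi).2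

/-- `g` is a density of the absolutely continuous function `f` on `[0, 1]`. -/
structure HasDensity (f g : ℝ → ℂ) : Prop where
  integrableOn : IntegrableOn g (Set.Icc 0 1)
  eq_add_integral : ∀ x ∈ Set.Icc (0 : ℝ) 1, f x = f 0 + ∫ t in (0 : ℝ)..x, g t

namespace HasDensity

variable {f g f₁ f₂ g₁ g₂ : ℝ → ℂ}

theorem intervalIntegrable_of_mem {E : Type*} [NormedAddCommGroup E] {g : ℝ → E}
    (hg : IntegrableOn g (Set.Icc 0 1)) {x y : ℝ} (hx : x ∈ Set.Icc (0 : ℝ) 1)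
    (hy : y ∈ Set.Icc (0 : ℝ) 1) : IntervalIntegrable g volume x y := by
  rw [intervalIntegrable_iff]
  refine hg.mono_set (Set.uIoc_subset_uIcc.trans ?_)
  exact Set.uIcc_subset_Icc hx hy

theorem zero_mem : (0 : ℝ) ∈ Set.Icc (0 : ℝ) 1 := by simp

theorem one_mem : (1 : ℝ) ∈ Set.Icc (0 : ℝ) 1 := by simp

theorem sub_eq_integral (h : HasDensity f g) {x y : ℝ} (hx : x ∈ Set.Icc (0 : ℝ) 1)
    (hy : y ∈ Set.Icc (0 : ℝ) 1) : f y - f x = ∫ t in x..y, g t := by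
  rw [h.eq_add_integral x hx, h.eq_add_integral y hy, add_sub_add_left_eq_sub,
    intervalIntegral.integral_interval_sub_left
      (intervalIntegrable_of_mem h.integrableOn zero_mem hy)
      (intervalIntegrable_of_mem h.integrableOn zero_mem hx)]

theorem absolutelyContinuousOnInterval (h : HasDensity f g) :
    AbsolutelyContinuousOnInterval f 0 1 := by
  have hn : IntegrableOn (fun t => ‖g t‖) (Set.Icc 0 1) := h.integrableOn.norm
  refine AbsolutelyContinuousOnInterval.of_dist_le 1
    ((intervalIntegrable_of_mem hn zero_mem
      one_mem).absolutelyContinuousOnInterval_intervalIntegral (c := 0) (by simp)) ?_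
  rw [Set.uIcc_of_le zero_le_one]
  intro x hx y hy
  rw [dist_comm, dist_eq_norm, h.sub_eq_integral hx hy, one_mul, dist_comm, Real.dist_eq,
    intervalIntegral.integral_interval_sub_left (intervalIntegrable_of_mem hn zero_mem hy)
      (intervalIntegrable_of_mem hn zero_mem hx)]
  exact intervalIntegral.norm_integral_le_abs_integral_norm

theorem continuousOn (h : HasDensity f g) : ContinuousOn f (Set.Icc 0 1) := by
  simpa using h.absolutelyContinuousOnInterval.continuousOn

theorem ae_hasDerivAt (h : HasDensity f g) :
    ∀ᵐ x, x ∈ Set.Ioo (0 : ℝ) 1 → HasDerivAt f (g x) x := by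
  filter_upwards [(intervalIntegrable_of_mem h.integrableOn zero_mem
    one_mem).ae_hasDerivAt_integral] with x hx hx'
  refine ((hx (by simpa using ⟨hx'.1.le, hx'.2.le⟩) 0 (by simp)).const_add
    (f 0)).congr_of_eventuallyEq ?_
  filter_upwards [Ioo_mem_nhds hx'.1 hx'.2] with y hy
  exact h.eq_add_integral y ⟨hy.1.le, hy.2.le⟩

theorem of_absolutelyContinuousOnInterval (hf : AbsolutelyContinuousOnInterval f 0 1)
    (hg : IntegrableOn g (Set.Icc 0 1))
    (h : ∀ᵐ x, x ∈ Set.Ioo (0 : ℝ) 1 → HasDerivAt f (g x) x) : HasDensity f g := by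
  have hG : HasDensity (fun x => ∫ t in (0 : ℝ)..x, g t) g := ⟨hg, fun x _ => by simp⟩
  obtain ⟨C, hC⟩ := (hf.fun_sub hG.absolutelyContinuousOnInterval).const_of_ae_hasDerivAt_zero (by
    have h0 : ∀ᵐ x : ℝ, x ≠ 0 := by simp [ae_iff, measure_singleton]
    have h1 : ∀ᵐ x : ℝ, x ≠ 1 := by simp [ae_iff, measure_singleton]
    filter_upwards [h, hG.ae_hasDerivAt, h0, h1] with x hx hx' hx0 hx1 hmem
    rw [Set.uIcc_of_le zero_le_one] at hmem
    have hm : x ∈ Set.Ioo (0 : ℝ) 1 := ⟨hmem.1.lt_of_ne' hx0, hmem.2.lt_of_ne hx1⟩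
    simpa using (hx hm).fun_sub (hx' hm))
  rw [Set.uIcc_of_le zero_le_one] at hC
  refine ⟨hg, fun x hx => ?_⟩
  have e0 := hC 0 zero_mem
  have ex := hC x hx
  simp only [intervalIntegral.integral_same, sub_zero] at e0
  rw [e0, ← ex]
  ring

theorem congr_density (h : HasDensity f g₁) (hg : Set.EqOn g₁ g₂ (Set.Icc 0 1)) :
    HasDensity f g₂ := by
  refine ⟨h.integrableOn.congr_fun hg measurableSet_Icc, fun x hx => ?_⟩
  rw [h.eq_add_integral x hx]
  congr 1
  refine intervalIntegral.integral_congr fun t ht => hg ?_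
  exact Set.uIcc_subset_Icc zero_mem hx ht

theorem congr_left (h : HasDensity f₁ g) (hf : Set.EqOn f₁ f₂ (Set.Icc 0 1)) :
    HasDensity f₂ g :=
  ⟨h.integrableOn, fun x hx => by
    rw [← hf hx, ← hf zero_mem, h.eq_add_integral x hx]⟩

theorem add (h₁ : HasDensity f₁ g₁) (h₂ : HasDensity f₂ g₂) :
    HasDensity (fun x => f₁ x + f₂ x) (fun x => g₁ x + g₂ x) := by
  refine ⟨h₁.integrableOn.add h₂.integrableOn, fun x hx => ?_⟩
  rw [intervalIntegral.integral_add (intervalIntegrable_of_mem h₁.integrableOn zero_mem hx)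
    (intervalIntegrable_of_mem h₂.integrableOn zero_mem hx), h₁.eq_add_integral x hx,
    h₂.eq_add_integral x hx]
  ring

theorem const_mul (c : ℂ) (h : HasDensity f g) :
    HasDensity (fun x => c * f x) (fun x => c * g x) := by
  refine ⟨h.integrableOn.const_mul c, fun x hx => ?_⟩
  rw [intervalIntegral.integral_const_mul, h.eq_add_integral x hx]
  ring

theorem mul (h₁ : HasDensity f₁ g₁) (h₂ : HasDensity f₂ g₂) :
    HasDensity (fun x => f₁ x * f₂ x) (fun x => g₁ x * f₂ x + f₁ x * g₂ x) := by
  refine of_absolutelyContinuousOnInterval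
    (h₁.absolutelyContinuousOnInterval.smul h₂.absolutelyContinuousOnInterval) ?_ ?_
  · exact (h₁.integrableOn.mul_continuousOn h₂.continuousOn isCompact_Icc).add
      (h₂.integrableOn.continuousOn_mul h₁.continuousOn isCompact_Icc)
  · filter_upwards [h₁.ae_hasDerivAt, h₂.ae_hasDerivAt] with x hx₁ hx₂ hx
    exact (hx₁ hx).fun_mul (hx₂ hx)

theorem pow (h : HasDensity f g) (n : ℕ) :
    HasDensity (fun x => f x ^ (n + 1)) (fun x => (n + 1) * (f x ^ n * g x)) := by
  induction n with
  | zero => simpa using h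
  | succ n ih =>
    simp_rw [pow_succ (n := n + 1)]
    refine (ih.mul h).congr_density fun x _ => ?_
    push_cast
    ring

end HasDensity

namespace HasDensity

theorem const (c : ℂ) : HasDensity (fun _ => c) (fun _ => 0) :=
  ⟨integrableOn_zero, fun x _ => by simp⟩

theorem tsum {F G : ℕ → ℝ → ℂ} {κ : ℝ → ℝ} {c : ℕ → ℝ} (h : ∀ m, HasDensity (F m) (G m))
    (h0 : Summable fun m => F m 0) (hκ : IntegrableOn κ (Set.Icc 0 1)) (hc : Summable c)
    (hG : ∀ m, ∀ t ∈ Set.Icc (0 : ℝ) 1, ‖G m t‖ ≤ κ t * c m) :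
    HasDensity (fun x => ∑' m, F m x) (fun t => ∑' m, G m t) := by
  have hsum : ∀ t ∈ Set.Icc (0 : ℝ) 1, Summable fun m => G m t := fun t ht =>
    Summable.of_norm_bounded (hc.mul_left (κ t)) fun m => hG m t ht
  have hint : IntegrableOn (fun t => ∑' m, G m t) (Set.Icc 0 1) := by
    refine Integrable.mono' (hκ.mul_const (∑' m, c m)) ?_ ?_
    · refine aestronglyMeasurable_of_tendsto_ae atTop
        (f := fun N t => ∑ m ∈ Finset.range N, G m t) (fun N => ?_) ?_
      · exact Finset.aestronglyMeasurable_fun_sum _ fun m _ => (h m).integrableOn.1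
      · filter_upwards [ae_restrict_mem measurableSet_Icc] with t ht
        exact (hsum t ht).hasSum.tendsto_sum_nat
    · filter_upwards [ae_restrict_mem measurableSet_Icc] with t ht
      rw [← tsum_mul_left]
      exact tsum_of_norm_bounded (hc.mul_left (κ t)).hasSum fun m => hG m t ht
  refine ⟨hint, fun x hx => ?_⟩
  have hmem : ∀ t ∈ Set.uIoc 0 x, t ∈ Set.Icc (0 : ℝ) 1 := fun t ht =>
    Set.uIcc_subset_Icc zero_mem hx (Set.uIoc_subset_uIcc ht)
  have hs : HasSum (fun m => ∫ t in (0 : ℝ)..x, G m t) (∫ t in (0 : ℝ)..x, ∑' m, G m t) := by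
    refine intervalIntegral.hasSum_integral_of_dominated_convergence (fun m t => κ t * c m)
      (fun m => ?_) (fun m => .of_forall fun t ht => hG m t (hmem t ht))
      (.of_forall fun t ht => hc.mul_left (κ t)) ?_
      (.of_forall fun t ht => (hsum t (hmem t ht)).hasSum)
    · exact (intervalIntegrable_iff.1
        (intervalIntegrable_of_mem (h m).integrableOn zero_mem hx)).aestronglyMeasurable
    · simp_rw [tsum_mul_left]
      exact (intervalIntegrable_of_mem hκ zero_mem hx).mul_const _
  rw [← (h0.hasSum.add hs).tsum_eq]
  exact tsum_congr fun m => (h m).eq_add_integral x hx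

end HasDensity

section Series

variable {f : ℕ → ℝ → ℂ}

theorem simplexIntegral_self_succ (f : ℕ → ℝ → ℂ) (hf : ∀ p, Integrable (f p)) (a : ℝ) (n : ℕ) :
    simplexIntegral f a a (n + 1) = 0 := by
  simp [simplexIntegral_succ hf, Set.Icc_self]

theorem hasDensity_simplexIntegral (hf : ∀ p, Integrable (f p)) (n : ℕ) :
    HasDensity (fun x => simplexIntegral f 0 x (n + 1))
      (fun t => f n t * simplexIntegral f 0 t n) := by
  have key (n : ℕ) (hc : ContinuousOn (fun x => simplexIntegral f 0 x n) (Set.Icc 0 1)) :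
      HasDensity (fun x => simplexIntegral f 0 x (n + 1))
        (fun t => f n t * simplexIntegral f 0 t n) := by
    refine ⟨(hf n).integrableOn.mul_continuousOn hc isCompact_Icc, fun x hx => ?_⟩
    rw [simplexIntegral_self_succ f hf, zero_add, simplexIntegral_succ hf,
      intervalIntegral.integral_of_le hx.1, integral_Icc_eq_integral_Ioc]
  induction n with
  | zero => exact key 0 (by simpa [simplexIntegral_zero] using continuousOn_const)
  | succ n ih => exact key (n + 1) ih.continuousOn

theorem norm_simplexIntegral_le (hf : ∀ p, Integrable (f p)) {κ : ℝ → ℝ}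
    (hκ : IntegrableOn κ (Set.Icc 0 1)) (hfκ : ∀ p, ∀ t ∈ Set.Icc (0 : ℝ) 1, ‖f p t‖ ≤ κ t)
    (n : ℕ) {x : ℝ} (hx : x ∈ Set.Icc (0 : ℝ) 1) :
    ‖simplexIntegral f 0 x n‖ ≤ (∫ t in (0 : ℝ)..x, κ t) ^ n / n.factorial := by
  induction n generalizing x with
  | zero => simp [simplexIntegral_zero]
  | succ n ih =>
    set K : ℝ → ℝ := fun x => ∫ t in (0 : ℝ)..x, κ t with hK
    have hKd : HasDensity (fun x => (K x : ℂ)) (fun t => (κ t : ℂ)) :=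
      ⟨hκ.ofReal, fun x _ => by simp [hK, intervalIntegral.integral_ofReal]⟩
    have hp := (hKd.pow n).const_mul (((n + 1).factorial : ℂ)⁻¹)
    have hreal : ∫ t in (0 : ℝ)..x, κ t * (K t ^ n / n.factorial) =
        K x ^ (n + 1) / (n + 1).factorial := by
      have := hp.eq_add_integral x hx
      have hn : ((n.factorial : ℝ)) ≠ 0 := by positivity
      have hn' : ((n.factorial : ℂ)) ≠ 0 := by exact_mod_cast hn
      have hn1 : (n : ℂ) + 1 ≠ 0 := by exact_mod_cast n.succ_ne_zero
      have e : ∀ t, ((n + 1).factorial : ℂ)⁻¹ * ((n + 1) * ((K t : ℂ) ^ n * (κ t : ℂ))) =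
          ((κ t * (K t ^ n / n.factorial) : ℝ) : ℂ) := fun t => by
        rw [Nat.factorial_succ]
        push_cast
        field_simp
      simp_rw [e, intervalIntegral.integral_ofReal] at this
      have h0 : K 0 = 0 := by simp [hK]
      rw [h0] at this
      have h2 : ((K x ^ (n + 1) / (n + 1).factorial : ℝ) : ℂ) =
          ((∫ t in (0 : ℝ)..x, κ t * (K t ^ n / n.factorial) : ℝ) : ℂ) := by
        rw [← zero_add ((∫ t in (0 : ℝ)..x, κ t * (K t ^ n / n.factorial) : ℝ) : ℂ)]
        push_cast
        push_cast at this
        rw [div_eq_inv_mul, this]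
        simp
      exact_mod_cast h2.symm
    have hKc : ContinuousOn K (Set.Icc 0 1) := by
      simpa [Function.comp_def] using
        Complex.continuous_re.comp_continuousOn hKd.continuousOn
    have h := (hasDensity_simplexIntegral hf n).eq_add_integral x hx
    simp only [simplexIntegral_self_succ f hf, zero_add] at h
    rw [h, ← hreal]
    refine intervalIntegral.norm_integral_le_of_norm_le hx.1 (.of_forall fun t ht => ?_) ?_
    · have ht' : t ∈ Set.Icc (0 : ℝ) 1 := ⟨ht.1.le, ht.2.trans hx.2⟩
      rw [norm_mul]
      exact mul_le_mul (hfκ n t ht') (ih ht') (norm_nonneg _) ((norm_nonneg _).trans (hfκ n t ht'))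
    · exact HasDensity.intervalIntegrable_of_mem (hκ.mul_continuousOn
        ((hKc.pow n).div_const _) isCompact_Icc) HasDensity.zero_mem hx

theorem norm_simplexIntegral_le_one (hf : ∀ p, Integrable (f p)) {κ : ℝ → ℝ}
    (hκ : IntegrableOn κ (Set.Icc 0 1)) (hfκ : ∀ p, ∀ t ∈ Set.Icc (0 : ℝ) 1, ‖f p t‖ ≤ κ t)
    (n : ℕ) {x : ℝ} (hx : x ∈ Set.Icc (0 : ℝ) 1) :
    ‖simplexIntegral f 0 x n‖ ≤ (∫ t in (0 : ℝ)..1, κ t) ^ n / n.factorial := by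
  have h0 : ∀ t ∈ Set.Icc (0 : ℝ) 1, 0 ≤ κ t := fun t ht => (norm_nonneg _).trans (hfκ 0 t ht)
  refine (norm_simplexIntegral_le hf hκ hfκ n hx).trans ?_
  gcongr
  · exact intervalIntegral.integral_nonneg hx.1 fun t ht => h0 t ⟨ht.1, ht.2.trans hx.2⟩
  · refine intervalIntegral.integral_mono_interval le_rfl hx.1 hx.2 ?_
      (HasDensity.intervalIntegrable_of_mem hκ HasDensity.zero_mem HasDensity.one_mem)
    filter_upwards [ae_restrict_mem measurableSet_Ioc] with t ht using h0 t ⟨ht.1.le, ht.2⟩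

theorem summable_simplexIntegral (hf : ∀ p, Integrable (f p)) {κ : ℝ → ℝ}
    (hκ : IntegrableOn κ (Set.Icc 0 1)) (hfκ : ∀ p, ∀ t ∈ Set.Icc (0 : ℝ) 1, ‖f p t‖ ≤ κ t)
    {x : ℝ} (hx : x ∈ Set.Icc (0 : ℝ) 1) : Summable fun n => simplexIntegral f 0 x n :=
  Summable.of_norm_bounded (Real.summable_pow_div_factorial _) fun n =>
    norm_simplexIntegral_le_one hf hκ hfκ n hx

theorem hasDensity_tsum_simplexIntegral (hf : ∀ p, Integrable (f p)) {κ : ℝ → ℝ}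
    (hκ : IntegrableOn κ (Set.Icc 0 1)) (hfκ : ∀ p, ∀ t ∈ Set.Icc (0 : ℝ) 1, ‖f p t‖ ≤ κ t)
    {φ : ℝ → ℂ} {i : ℕ → ℕ} (hi : i.Injective) (hφ : ∀ m, f (i m) = φ) :
    HasDensity (fun x => ∑' m, simplexIntegral f 0 x (i m + 1))
      (fun t => φ t * ∑' m, simplexIntegral f 0 t (i m)) := by
  have h := HasDensity.tsum (κ := κ) (fun m => hasDensity_simplexIntegral hf (i m))
    (by simp [simplexIntegral_self_succ f hf, summable_zero]) hκ
    ((Real.summable_pow_div_factorial (∫ t in (0 : ℝ)..1, κ t)).comp_injective hi)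
    (fun m t ht => by
      rw [norm_mul]
      exact mul_le_mul (hfκ _ t ht) (norm_simplexIntegral_le_one hf hκ hfκ _ ht) (norm_nonneg _)
        ((norm_nonneg _).trans (hfκ (i m) t ht)))
  simpa only [hφ, tsum_mul_left] using h

end Series

theorem HasDensity.comp {u u' : ℝ → ℝ} {φ φ' : ℝ → ℂ}
    (hu : HasDensity (fun x => (u x : ℂ)) (fun x => (u' x : ℂ)))
    (hφ : ∀ x ∈ Set.Icc (0 : ℝ) 1, HasDerivAt φ (φ' (u x)) (u x))
    (hφ' : ContinuousOn φ' (u '' Set.Icc 0 1)) :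
    HasDensity (fun x => φ (u x)) (fun x => u' x * φ' (u x)) := by
  have huc : ContinuousOn u (Set.Icc 0 1) := by
    simpa [Function.comp_def] using Complex.continuous_re.comp_continuousOn hu.continuousOn
  have hconv : Convex ℝ (u '' Set.Icc 0 1) :=
    (isPreconnected_Icc.image u huc).convex
  obtain ⟨C, hC⟩ := (isCompact_Icc.image_of_continuousOn huc).exists_bound_of_continuousOn hφ'
  refine .of_absolutelyContinuousOnInterval
    (.of_dist_le C hu.absolutelyContinuousOnInterval fun x hx y hy => ?_)
    (hu.integrableOn.mul_continuousOn
      (hφ'.comp huc (Set.mapsTo_image u _)) isCompact_Icc) ?_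
  · rw [Set.uIcc_of_le zero_le_one] at hx hy
    rw [dist_eq_norm, dist_eq_norm, ← Complex.ofReal_sub, Complex.norm_real]
    refine hconv.norm_image_sub_le_of_norm_hasDerivWithin_le (f' := φ') ?_ hC
      (Set.mem_image_of_mem u hy) (Set.mem_image_of_mem u hx)
    rintro _ ⟨z, hz, rfl⟩
    exact (hφ z hz).hasDerivWithinAt
  · filter_upwards [hu.ae_hasDerivAt] with x hx hx'
    have h : HasDerivAt u (u' x) x := by
      simpa [Function.comp_def] using Complex.reCLM.hasFDerivAt.comp_hasDerivAt x (hx hx')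
    simpa [Function.comp_def] using (hφ x ⟨hx'.1.le, hx'.2.le⟩).scomp x h

section Fundamental

variable {σ : ℝ → ℝ}

theorem sigmaAC.hasDensity (h : sigmaAC σ) :
    HasDensity (fun x => (σ x : ℂ)) (fun x => ((deriv σ x : ℝ) : ℂ)) :=
  ⟨h.1.ofReal, fun x hx => by
    rw [intervalIntegral.integral_ofReal, h.2 x hx]
    push_cast
    rfl⟩

theorem sigmaAC.continuousOn (h : sigmaAC σ) : ContinuousOn σ (Set.Icc 0 1) := by
  simpa [Function.comp_def] using
    Complex.continuous_re.comp_continuousOn h.hasDensity.continuousOn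

theorem continuousOn_one_div (hσpos : ∀ x ∈ Set.Icc (0 : ℝ) 1, 0 < σ x) (h : sigmaAC σ) :
    ContinuousOn (fun x => 1 / σ x) (Set.Icc 0 1) :=
  continuousOn_const.div h.continuousOn fun x hx => (hσpos x hx).ne'

theorem hasDensity_travelTime (hσpos : ∀ x ∈ Set.Icc (0 : ℝ) 1, 0 < σ x) (h : sigmaAC σ) :
    HasDensity (fun x => ((∫ t in (0 : ℝ)..x, 1 / σ t : ℝ) : ℂ))
      (fun x => ((1 / σ x : ℝ) : ℂ)) :=
  ⟨(continuousOn_one_div hσpos h).integrableOn_Icc.ofReal, fun x _ => by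
    rw [intervalIntegral.integral_ofReal]
    simp⟩

/-- The factors of the phase-expanded integrand of `S`, cut off outside `[0, 1]`. -/
def kernelFactor (σ : ℝ → ℝ) (k : ℝ) (p : ℕ) : ℝ → ℂ :=
  (Set.Icc (0 : ℝ) 1).indicator fun t => ((deriv σ t / σ t / 2 : ℝ) : ℂ) *
    Complex.exp (2 * (-1) ^ p * (k * Complex.I) * (∫ ξ in (0 : ℝ)..t, 1 / σ ξ : ℝ))

theorem hasDensity_exp (hσpos : ∀ x ∈ Set.Icc (0 : ℝ) 1, 0 < σ x) (h : sigmaAC σ) (c : ℂ) :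
    HasDensity (fun x => Complex.exp (c * (∫ t in (0 : ℝ)..x, 1 / σ t : ℝ)))
      (fun x => ((1 / σ x : ℝ) : ℂ) *
        (c * Complex.exp (c * (∫ t in (0 : ℝ)..x, 1 / σ t : ℝ)))) := by
  refine (hasDensity_travelTime hσpos h).comp (φ := fun s => Complex.exp (c * s))
    (φ' := fun s => c * Complex.exp (c * s)) (fun x _ => ?_) (by fun_prop)
  have := ((hasDerivAt_id (∫ t in (0 : ℝ)..x, 1 / σ t)).ofReal_comp.const_mul c).cexp
  simpa [mul_comm] using this

theorem integrable_kernelFactor (hσpos : ∀ x ∈ Set.Icc (0 : ℝ) 1, 0 < σ x) (h : sigmaAC σ)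
    (hratio : IntegrableOn (fun t => deriv σ t / σ t) (Set.Icc 0 1)) (k : ℝ) (p : ℕ) :
    Integrable (kernelFactor σ k p) := by
  rw [kernelFactor, integrable_indicator_iff measurableSet_Icc]
  have h1 : IntegrableOn (fun t => ((deriv σ t / σ t / 2 : ℝ) : ℂ)) (Set.Icc 0 1) :=
    (hratio.div_const 2).ofReal
  exact h1.mul_continuousOn (hasDensity_exp hσpos h _).continuousOn isCompact_Icc

theorem norm_kernelFactor_le (k : ℝ) (p : ℕ) {t : ℝ} (ht : t ∈ Set.Icc (0 : ℝ) 1) :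
    ‖kernelFactor σ k p t‖ ≤ ‖deriv σ t / σ t / 2‖ := by
  rw [kernelFactor, Set.indicator_of_mem ht, norm_mul, Complex.norm_real]
  have : 2 * (-1) ^ p * (k * Complex.I) * ((∫ ξ in (0 : ℝ)..t, 1 / σ ξ : ℝ) : ℂ) =
      ((2 * (-1) ^ p * k * (∫ ξ in (0 : ℝ)..t, 1 / σ ξ) : ℝ) : ℂ) * Complex.I := by
    push_cast
    ring
  rw [this, Complex.norm_exp_ofReal_mul_I, mul_one]

theorem hasDensity_sqrt (hσpos : ∀ x ∈ Set.Icc (0 : ℝ) 1, 0 < σ x) (h : sigmaAC σ) :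
    HasDensity (fun x => ((√(σ x) : ℝ) : ℂ))
      (fun x => ((deriv σ x : ℝ) : ℂ) * ((1 / (2 * √(σ x)) : ℝ) : ℂ)) := by
  refine h.hasDensity.comp (φ := fun s => ((√s : ℝ) : ℂ))
    (φ' := fun s => ((1 / (2 * √s) : ℝ) : ℂ)) (fun x hx => ?_) ?_
  · exact (Real.hasDerivAt_sqrt (hσpos x hx).ne').ofReal_comp
  · refine Complex.continuous_ofReal.comp_continuousOn (continuousOn_const.div (by fun_prop) ?_)
    rintro _ ⟨x, hx, rfl⟩
    have := Real.sqrt_pos.2 (hσpos x hx)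
    positivity

theorem hasDensity_inv_sqrt (hσpos : ∀ x ∈ Set.Icc (0 : ℝ) 1, 0 < σ x) (h : sigmaAC σ) :
    HasDensity (fun x => (((√(σ x))⁻¹ : ℝ) : ℂ))
      (fun x => ((deriv σ x : ℝ) : ℂ) * ((-(1 / (2 * √(σ x))) / √(σ x) ^ 2 : ℝ) : ℂ)) := by
  refine h.hasDensity.comp (φ := fun s => (((√s)⁻¹ : ℝ) : ℂ))
    (φ' := fun s => ((-(1 / (2 * √s)) / √s ^ 2 : ℝ) : ℂ)) (fun x hx => ?_) ?_
  · exact ((Real.hasDerivAt_sqrt (hσpos x hx).ne').fun_inv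
      (Real.sqrt_pos.2 (hσpos x hx)).ne').ofReal_comp
  · refine Complex.continuous_ofReal.comp_continuousOn
      ((continuousOn_const.div (by fun_prop) ?_).neg.div (by fun_prop) ?_)
    all_goals
      rintro _ ⟨x, hx, rfl⟩
      have := Real.sqrt_pos.2 (hσpos x hx)
      positivity

theorem exists_fundamental (hσpos : ∀ x ∈ Set.Icc (0 : ℝ) 1, 0 < σ x) (h : sigmaAC σ)
    (hratio : IntegrableOn (fun t => deriv σ t / σ t) (Set.Icc 0 1)) (k : ℝ) :
    ∃ Y W : ℝ → ℂ, HasDensity Y (fun x => k * Complex.I * W x / (σ x : ℂ) ^ 2) ∧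
      HasDensity W (fun x => k * Complex.I * Y x) ∧
      Y 0 = (((√(σ 0))⁻¹ : ℝ) : ℂ) ∧ W 0 = ((√(σ 0) : ℝ) : ℂ) ∧
      HasSum (fun n : ℕ => Complex.exp ((-1) ^ n * (k * Complex.I) *
        (∫ ξ in (0 : ℝ)..1, 1 / σ ξ : ℝ)) * simplexIntegral (kernelFactor σ k) 0 1 n)
        (((√(σ 1) : ℝ) : ℂ) * Y 1) := by
  set f := kernelFactor σ k with hf_def
  have hf := integrable_kernelFactor hσpos h hratio k
  have hκ : IntegrableOn (fun t => ‖deriv σ t / σ t / 2‖) (Set.Icc 0 1) :=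
    (hratio.div_const 2).norm
  have hfκ : ∀ p, ∀ t ∈ Set.Icc (0 : ℝ) 1, ‖f p t‖ ≤ ‖deriv σ t / σ t / 2‖ :=
    fun p t ht => norm_kernelFactor_le k p ht
  have heven (m : ℕ) : f (2 * m) = f 0 := by simp [hf_def, kernelFactor, pow_mul]
  have hodd (m : ℕ) : f (2 * m + 1) = f 1 := by simp [hf_def, kernelFactor, pow_mul, pow_succ]
  have hinj : Function.Injective fun m : ℕ => 2 * m := fun a b hab => by simpa using hab
  have hinj' : Function.Injective fun m : ℕ => 2 * m + 1 := fun a b hab => by simpa using hab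
  have hsum {x : ℝ} (hx : x ∈ Set.Icc (0 : ℝ) 1) := summable_simplexIntegral hf hκ hfκ hx
  set Be : ℝ → ℂ := fun x => ∑' m, simplexIntegral f 0 x (2 * m) with hBe
  set Bo : ℝ → ℂ := fun x => ∑' m, simplexIntegral f 0 x (2 * m + 1) with hBo
  have hBod : HasDensity Bo (fun t => f 0 t * Be t) :=
    hasDensity_tsum_simplexIntegral hf hκ hfκ hinj heven
  have hBed : HasDensity Be (fun t => f 1 t * Bo t) := by
    have := (HasDensity.const 1).add
      (hasDensity_tsum_simplexIntegral hf hκ hfκ hinj' hodd)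
    simp only [zero_add] at this
    refine this.congr_left fun x hx => ?_
    have hs := ((hsum hx).comp_injective hinj).tsum_eq_zero_add
    simp only [Function.comp_def, mul_zero, simplexIntegral_zero] at hs
    exact hs.symm
  have hBe0 : Be 0 = 1 := by
    rw [hBe]
    refine (tsum_eq_single 0 fun m hm => ?_).trans (by simp [simplexIntegral_zero])
    obtain ⟨j, rfl⟩ := Nat.exists_eq_succ_of_ne_zero hm
    exact simplexIntegral_self_succ f hf 0 (2 * j + 1)
  have hBo0 : Bo 0 = 0 := by
    simp [hBo, simplexIntegral_self_succ f hf]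
  set θ : ℝ → ℝ := fun x => ∫ t in (0 : ℝ)..x, 1 / σ t with hθ
  set E : ℝ → ℂ := fun x => Complex.exp (k * Complex.I * θ x) with hE
  set E' : ℝ → ℂ := fun x => Complex.exp (-(k * Complex.I) * θ x) with hE'
  have hEd : HasDensity E (fun x => ((1 / σ x : ℝ) : ℂ) * (k * Complex.I * E x)) :=
    hasDensity_exp hσpos h _
  have hEd' : HasDensity E' (fun x => ((1 / σ x : ℝ) : ℂ) * (-(k * Complex.I) * E' x)) :=
    hasDensity_exp hσpos h _
  have hEE' (x : ℝ) : E x * E' x = 1 := by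
    rw [hE, hE', ← Complex.exp_add]
    simp
  have hf0 {x : ℝ} (hx : x ∈ Set.Icc (0 : ℝ) 1) :
      f 0 x = (deriv σ x : ℝ) / σ x / 2 * (E x * E x) := by
    rw [hf_def, kernelFactor, Set.indicator_of_mem hx, hE, ← Complex.exp_add]
    push_cast
    congr 2
    ring
  have hf1 {x : ℝ} (hx : x ∈ Set.Icc (0 : ℝ) 1) :
      f 1 x = (deriv σ x : ℝ) / σ x / 2 * (E' x * E' x) := by
    rw [hf_def, kernelFactor, Set.indicator_of_mem hx, hE', ← Complex.exp_add]
    push_cast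
    congr 2
    ring
  have hEf {x : ℝ} (hx : x ∈ Set.Icc (0 : ℝ) 1) :
      E x * (f 1 x * Bo x) = (deriv σ x : ℝ) / σ x / 2 * (E' x * Bo x) := by
    rw [hf1 hx]
    linear_combination ((deriv σ x : ℝ) / σ x / 2 * E' x * Bo x : ℂ) * hEE' x
  have hEf' {x : ℝ} (hx : x ∈ Set.Icc (0 : ℝ) 1) :
      E' x * (f 0 x * Be x) = (deriv σ x : ℝ) / σ x / 2 * (E x * Be x) := by
    rw [hf0 hx]
    linear_combination ((deriv σ x : ℝ) / σ x / 2 * E x * Be x : ℂ) * hEE' x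
  have hP := hEd.mul hBed
  have hQ := hEd'.mul hBod
  refine ⟨fun x => (((√(σ x))⁻¹ : ℝ) : ℂ) * (E x * Be x + E' x * Bo x),
    fun x => ((√(σ x) : ℝ) : ℂ) * (E x * Be x + -1 * (E' x * Bo x)), ?_, ?_, ?_, ?_, ?_⟩
  · refine ((hasDensity_inv_sqrt hσpos h).mul (hP.add hQ)).congr_density fun x hx => ?_
    simp only [hEf hx, hEf' hx]
    have hs := Real.sqrt_pos.2 (hσpos x hx)
    have hs' : ((√(σ x) : ℝ) : ℂ) ≠ 0 := by exact_mod_cast hs.ne'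
    have hσ : (σ x : ℂ) = ((√(σ x) : ℝ) : ℂ) ^ 2 := by
      exact_mod_cast (Real.sq_sqrt (hσpos x hx).le).symm
    push_cast
    rw [hσ]
    field_simp
    ring
  · refine ((hasDensity_sqrt hσpos h).mul (hP.add (hQ.const_mul (-1)))).congr_density
      fun x hx => ?_
    simp only [hEf hx, hEf' hx]
    have hs := Real.sqrt_pos.2 (hσpos x hx)
    have hs' : ((√(σ x) : ℝ) : ℂ) ≠ 0 := by exact_mod_cast hs.ne'
    have hσ : (σ x : ℂ) = ((√(σ x) : ℝ) : ℂ) ^ 2 := by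
      exact_mod_cast (Real.sq_sqrt (hσpos x hx).le).symm
    push_cast
    rw [hσ]
    field_simp
    ring
  · simp [hBe0, hBo0, hE, hθ]
  · simp [hBe0, hBo0, hE, hθ]
  · have hs := Real.sqrt_pos.2 (hσpos 1 HasDensity.one_mem)
    have hs' : ((√(σ 1) : ℝ) : ℂ) ≠ 0 := by exact_mod_cast hs.ne'
    have key : ((√(σ 1) : ℝ) : ℂ) * ((((√(σ 1))⁻¹ : ℝ) : ℂ) * (E 1 * Be 1 + E' 1 * Bo 1)) =
        E 1 * Be 1 + E' 1 * Bo 1 := by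
      push_cast
      field_simp
    rw [key]
    refine HasSum.even_add_odd ?_ ?_
    · simpa [pow_mul, hE, hθ] using
        (((hsum HasDensity.one_mem).comp_injective hinj).hasSum.mul_left (E 1))
    · simpa [pow_mul, pow_succ, hE', hθ] using
        (((hsum HasDensity.one_mem).comp_injective hinj').hasSum.mul_left (E' 1))

end Fundamental

theorem sum_range_alternating_sub (g : ℕ → ℝ) (n : ℕ) :
    ∑ p ∈ Finset.range (n + 1), (-1 : ℝ) ^ p * (g (p + 1) - g p) =
      ∑ p ∈ Finset.range n, 2 * (-1) ^ p * g (p + 1) + (-1) ^ n * g (n + 1) - g 0 := by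
  induction n with
  | zero => simp
  | succ n ih =>
    rw [Finset.sum_range_succ, ih, Finset.sum_range_succ]
    ring

theorem nodes_mem_Icc {a b : ℝ} (hab : a ≤ b) {n : ℕ} {y : Fin n → ℝ} (hy : y ∈ simplex a b n)
    (p : ℕ) : nodes a b n y p ∈ Set.Icc a b := by
  unfold nodes
  split_ifs
  · exact hy.2 _
  · exact Set.left_mem_Icc.2 hab
  · exact Set.right_mem_Icc.2 hab

theorem nodes_zero (a b : ℝ) (n : ℕ) (y : Fin n → ℝ) : nodes a b n y 0 = a := by simp [nodes]

theorem nodes_last (a b : ℝ) (n : ℕ) (y : Fin n → ℝ) : nodes a b n y (n + 1) = b := by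
  simp [nodes]

theorem nodes_succ (a b : ℝ) {n : ℕ} (y : Fin n → ℝ) (p : Fin n) :
    nodes a b n y (p + 1) = y p := by
  have : (p : ℕ) + 1 ≤ n := p.2
  simp [nodes, this]

theorem HasDensity.clm {f g : ℝ → ℂ} (h : HasDensity f g) (L : ℂ →L[ℝ] ℂ) :
    HasDensity (fun x => L (f x)) (fun x => L (g x)) :=
  ⟨L.integrable_comp h.integrableOn, fun x hx => by
    rw [h.eq_add_integral x hx, map_add, ← L.intervalIntegral_comp_comm
      (HasDensity.intervalIntegrable_of_mem h.integrableOn HasDensity.zero_mem hx)]⟩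

section PhaseExpansion

variable {σ : ℝ → ℝ}

theorem phase_eq (hσpos : ∀ x ∈ Set.Icc (0 : ℝ) 1, 0 < σ x) (h : sigmaAC σ) {n : ℕ}
    {y : Fin n → ℝ} (hy : y ∈ simplex 0 1 n) :
    phase σ 0 1 n y = ∑ p : Fin n, 2 * (-1) ^ (p : ℕ) * (∫ ξ in (0 : ℝ)..y p, 1 / σ ξ) +
      (-1) ^ n * ∫ ξ in (0 : ℝ)..1, 1 / σ ξ := by
  have hint := (continuousOn_one_div hσpos h).integrableOn_Icc (μ := volume)
  have hsub (p : ℕ) : ∫ ξ in (nodes 0 1 n y p)..(nodes 0 1 n y (p + 1)), 1 / σ ξ =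
      (∫ ξ in (0 : ℝ)..nodes 0 1 n y (p + 1), 1 / σ ξ) -
        ∫ ξ in (0 : ℝ)..nodes 0 1 n y p, 1 / σ ξ :=
    (intervalIntegral.integral_interval_sub_left
      (HasDensity.intervalIntegrable_of_mem hint HasDensity.zero_mem
        (nodes_mem_Icc zero_le_one hy _))
      (HasDensity.intervalIntegrable_of_mem hint HasDensity.zero_mem
        (nodes_mem_Icc zero_le_one hy _))).symm
  simp only [phase, hsub]
  rw [sum_range_alternating_sub fun p => ∫ ξ in (0 : ℝ)..nodes 0 1 n y p, 1 / σ ξ,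
    nodes_zero, nodes_last, intervalIntegral.integral_same, sub_zero, ← Fin.sum_univ_eq_sum_range
      fun p => 2 * (-1 : ℝ) ^ p * ∫ ξ in (0 : ℝ)..nodes 0 1 n y (p + 1), 1 / σ ξ]
  simp only [nodes_succ]

theorem Sintegrand_eq (hσpos : ∀ x ∈ Set.Icc (0 : ℝ) 1, 0 < σ x) (h : sigmaAC σ) (k : ℝ) {n : ℕ}
    {y : Fin n → ℝ} (hy : y ∈ simplex 0 1 n) :
    ((2 : ℂ) ^ n)⁻¹ * Sintegrand σ 0 1 n k y =
      (((Complex.exp ((-1) ^ n * (k * Complex.I) * (∫ ξ in (0 : ℝ)..1, 1 / σ ξ : ℝ)) *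
        ∏ p : Fin n, kernelFactor σ k p (y p)).im : ℝ) : ℂ) := by
  have hprod : Complex.exp ((-1) ^ n * (k * Complex.I) * (∫ ξ in (0 : ℝ)..1, 1 / σ ξ : ℝ)) *
      ∏ p : Fin n, kernelFactor σ k p (y p) =
      (((2 ^ n)⁻¹ * ∏ p, deriv σ (y p) / σ (y p) : ℝ) : ℂ) *
        Complex.exp (((k * phase σ 0 1 n y : ℝ) : ℂ) * Complex.I) := by
    have hk (p : Fin n) : kernelFactor σ k p (y p) =
        ((deriv σ (y p) / σ (y p) / 2 : ℝ) : ℂ) *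
          Complex.exp (2 * (-1) ^ (p : ℕ) * (k * Complex.I) *
            (∫ ξ in (0 : ℝ)..y p, 1 / σ ξ : ℝ)) :=
      Set.indicator_of_mem (hy.2 p) _
    simp only [hk, Finset.prod_mul_distrib, ← Complex.exp_sum, phase_eq hσpos h hy]
    rw [mul_left_comm, ← Complex.exp_add, ← Complex.ofReal_prod, Finset.prod_div_distrib,
      Finset.prod_const, Finset.card_univ, Fintype.card_fin, div_eq_inv_mul]
    congr 2
    push_cast
    rw [mul_add, add_mul, Finset.mul_sum, Finset.sum_mul, add_comm]
    congr 1
    · exact Finset.sum_congr rfl fun p _ => by ring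
    · ring
  rw [hprod, Complex.im_ofReal_mul, Complex.exp_ofReal_mul_I_im, Sintegrand]
  push_cast
  ring

theorem S_eq (hσpos : ∀ x ∈ Set.Icc (0 : ℝ) 1, 0 < σ x) (h : sigmaAC σ)
    (hratio : IntegrableOn (fun t => deriv σ t / σ t) (Set.Icc 0 1)) (k : ℝ) (n : ℕ) :
    S σ 0 1 n k =
      (((Complex.exp ((-1) ^ n * (k * Complex.I) * (∫ ξ in (0 : ℝ)..1, 1 / σ ξ : ℝ)) *
        simplexIntegral (kernelFactor σ k) 0 1 n).im : ℝ) : ℂ) := by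
  have hint : Integrable fun y : Fin n → ℝ => ∏ p : Fin n, kernelFactor σ k p (y p) :=
    .fintype_prod fun p => integrable_kernelFactor hσpos h hratio k p
  rw [S, ← integral_const_mul, setIntegral_congr_fun (measurableSet_simplex 0 1 n)
    fun y hy => Sintegrand_eq hσpos h k hy, simplexIntegral, ← integral_const_mul]
  refine integral_ofReal.trans (congrArg _ ?_)
  exact integral_im (hint.integrableOn.const_mul _)

theorem exists_real_solution (hσpos : ∀ x ∈ Set.Icc (0 : ℝ) 1, 0 < σ x) (h : sigmaAC σ)
    (hratio : IntegrableOn (fun t => deriv σ t / σ t) (Set.Icc 0 1)) {k : ℝ} (hk : k ≠ 0) :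
    ∃ y w : ℝ → ℂ, HasDensity y (fun x => w x / (σ x : ℂ) ^ 2) ∧
      HasDensity w (fun x => (-k ^ 2 : ℂ) * y x) ∧ y 0 = 0 ∧ w 0 ≠ 0 ∧
      (y 1 = 0 ↔ Δfun σ k = 0) := by
  obtain ⟨Y, W, hY, hW, hY0, hW0, hsum⟩ := exists_fundamental hσpos h hratio k
  refine ⟨fun x => ((Y x).im : ℂ), fun x => k * ((W x).re : ℂ),
    (hY.clm (Complex.ofRealCLM.comp Complex.imCLM)).congr_density fun x _ => ?_,
    ((hW.clm (Complex.ofRealCLM.comp Complex.reCLM)).const_mul k).congr_density fun x _ => ?_,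
    by simp [hY0], ?_, ?_⟩
  · have : k * Complex.I * W x / (σ x : ℂ) ^ 2 =
        ((k / σ x ^ 2 : ℝ) : ℂ) * (Complex.I * W x) := by
      push_cast
      ring
    simp only [this, ContinuousLinearMap.comp_apply, Complex.imCLM_apply,
      Complex.ofRealCLM_apply, Complex.im_ofReal_mul, Complex.I_mul_im]
    push_cast
    ring
  · simp only [mul_assoc, ContinuousLinearMap.comp_apply, Complex.reCLM_apply,
      Complex.ofRealCLM_apply, Complex.re_ofReal_mul, Complex.I_mul_re]
    push_cast
    ring
  · have := (Real.sqrt_pos.2 (hσpos 0 HasDensity.zero_mem)).ne'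
    simp [hW0, hk, this]
  · have hΔ : Δfun σ k = ((√(σ 1) * (Y 1).im : ℝ) : ℂ) := by
      rw [Δfun, ← Complex.im_ofReal_mul]
      simp only [S_eq hσpos h hratio]
      exact (Complex.hasSum_ofReal.2 (Complex.hasSum_im hsum)).tsum_eq
    have := (Real.sqrt_pos.2 (hσpos 1 HasDensity.one_mem)).ne'
    rw [hΔ, Complex.ofReal_eq_zero, Complex.ofReal_eq_zero, mul_eq_zero, or_iff_right this]

end PhaseExpansion

namespace HasDensity

variable {f g g₁ g₂ : ℝ → ℂ}

theorem congr_density_ae (h : HasDensity f g₁)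
    (hg : ∀ᵐ x, x ∈ Set.Ioo (0 : ℝ) 1 → g₁ x = g₂ x) : HasDensity f g₂ := by
  have hae : g₁ =ᵐ[volume.restrict (Set.Icc 0 1)] g₂ := by
    rw [← restrict_Ioo_eq_restrict_Icc]
    exact (ae_restrict_iff' measurableSet_Ioo).2 hg
  refine ⟨h.integrableOn.congr hae, fun x hx => ?_⟩
  rw [h.eq_add_integral x hx, intervalIntegral.integral_congr_ae_restrict]
  rw [Set.uIoc_of_le hx.1]
  exact ae_restrict_of_ae_restrict_of_subset
    (Set.Ioc_subset_Icc_self.trans (Set.Icc_subset_Icc_right hx.2)) hae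

theorem exists_hasDerivAt (h : HasDensity f g) (hg : ContinuousOn g (Set.Icc 0 1)) :
    ∃ F : ℝ → ℂ, Set.EqOn F f (Set.Icc 0 1) ∧
      ∀ x ∈ Set.Icc (0 : ℝ) 1, HasDerivAt F (g x) x := by
  have hc : Continuous (Set.IccExtend (zero_le_one (α := ℝ)) ((Set.Icc 0 1).domRestrict g)) :=
    (continuousOn_iff_continuous_domRestrict.1 hg).Icc_extend'
  have he : ∀ x ∈ Set.Icc (0 : ℝ) 1,
      Set.IccExtend (zero_le_one (α := ℝ)) ((Set.Icc 0 1).domRestrict g) x = g x :=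
    fun x hx => Set.IccExtend_of_mem _ _ hx
  refine ⟨fun x => f 0 + ∫ t in (0 : ℝ)..x, Set.IccExtend (zero_le_one (α := ℝ))
    ((Set.Icc 0 1).domRestrict g) t, fun x hx => ?_, fun x hx => ?_⟩
  · rw [h.eq_add_integral x hx]
    exact congrArg (f 0 + ·) (intervalIntegral.integral_congr fun t ht =>
      he t (Set.uIcc_subset_Icc zero_mem hx ht))
  · rw [← he x hx]
    exact (hc.integral_hasStrictDerivAt 0 x).hasDerivAt.const_add _

end HasDensity

section SturmLiouville

variable {σ : ℝ → ℝ} {lam : ℂ} {y w : ℝ → ℂ}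

theorem continuousOn_div_sq (hσpos : ∀ x ∈ Set.Icc (0 : ℝ) 1, 0 < σ x) (h : sigmaAC σ)
    (hw : ContinuousOn w (Set.Icc 0 1)) :
    ContinuousOn (fun x => w x / (σ x : ℂ) ^ 2) (Set.Icc 0 1) :=
  hw.div (h.hasDensity.continuousOn.pow 2) fun x hx => by
    simpa using (hσpos x hx).ne'

theorem solution_eq_zero (hσpos : ∀ x ∈ Set.Icc (0 : ℝ) 1, 0 < σ x) (h : sigmaAC σ)
    (hy : HasDensity y fun x => w x / (σ x : ℂ) ^ 2) (hw : HasDensity w fun x => lam * y x)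
    (hy0 : y 0 = 0) (hw0 : w 0 = 0) : ∀ x ∈ Set.Icc (0 : ℝ) 1, y x = 0 := by
  obtain ⟨F, hFy, hF⟩ := hy.exists_hasDerivAt (continuousOn_div_sq hσpos h hw.continuousOn)
  obtain ⟨G, hGw, hG⟩ := hw.exists_hasDerivAt (continuousOn_const.mul hy.continuousOn)
  obtain ⟨C, hC⟩ := isCompact_Icc.exists_bound_of_continuousOn
    (continuousOn_div_sq hσpos h (continuousOn_const (c := 1)))
  have hFG : ∀ x ∈ Set.Icc (0 : ℝ) 1, HasDerivAt (fun x => (F x, G x))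
      (w x / (σ x : ℂ) ^ 2, lam * y x) x := fun x hx => (hF x hx).prodMk (hG x hx)
  have hzero := eq_zero_of_abs_deriv_le_mul_abs_self_of_eq_zero_right (K := max C ‖lam‖)
    (fun x hx => (hFG x hx).continuousAt.continuousWithinAt)
    (fun x hx => (hFG x (Set.Ico_subset_Icc_self hx)).hasDerivWithinAt)
    (by simp [hFy HasDensity.zero_mem, hGw HasDensity.zero_mem, hy0, hw0]) fun x hx => by
      have hx' := Set.Ico_subset_Icc_self hx
      have hCx := hC x hx'
      have hC0 := (norm_nonneg _).trans hCx
      rw [hFy hx', hGw hx', Prod.norm_mk, Prod.norm_mk, norm_mul, div_eq_mul_one_div, norm_mul,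
        mul_comm ‖w x‖]
      refine max_le ?_ ?_
      · exact mul_le_mul (hCx.trans (le_max_left _ _)) (le_max_right _ _) (norm_nonneg _)
          (hC0.trans (le_max_left _ _))
      · exact mul_le_mul (le_max_right _ _) (le_max_left _ _) (norm_nonneg _)
          (hC0.trans (le_max_left _ _))
  intro x hx
  rw [← hFy hx]
  exact congrArg Prod.fst (hzero x hx)

theorem eigenvalue_neg (hσpos : ∀ x ∈ Set.Icc (0 : ℝ) 1, 0 < σ x) (h : sigmaAC σ)
    (hy : HasDensity y fun x => w x / (σ x : ℂ) ^ 2) (hw : HasDensity w fun x => lam * y x)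
    (hy0 : y 0 = 0) (hy1 : y 1 = 0) (hne : ¬ ∀ x ∈ Set.Icc (0 : ℝ) 1, y x = 0) :
    ∃ μ : ℝ, μ < 0 ∧ lam = μ := by
  have hyc := hy.continuousOn
  have hwc := hw.continuousOn
  have hσc := h.continuousOn
  have hA : ContinuousOn (fun x => ‖y x‖ ^ 2) (Set.Icc 0 1) := hyc.norm.pow 2
  have hB : ContinuousOn (fun x => ‖w x‖ ^ 2 / σ x ^ 2) (Set.Icc 0 1) :=
    (hwc.norm.pow 2).div (hσc.pow 2) fun x hx => (pow_pos (hσpos x hx) 2).ne'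
  have hApos : 0 < ∫ x in (0 : ℝ)..1, ‖y x‖ ^ 2 := by
    push Not at hne
    obtain ⟨c, hc, hyc⟩ := hne
    exact intervalIntegral.integral_pos zero_lt_one hA (fun x _ => by positivity)
      ⟨c, hc, by positivity⟩
  have hBpos : 0 < ∫ x in (0 : ℝ)..1, ‖w x‖ ^ 2 / σ x ^ 2 := by
    have : ∃ c ∈ Set.Icc (0 : ℝ) 1, w c ≠ 0 := by
      by_contra! hw'
      have hy' : HasDensity y fun _ => 0 := hy.congr_density fun x hx => by simp [hw' x hx]
      exact hne fun x hx => by simpa [hy0] using hy'.eq_add_integral x hx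
    obtain ⟨c, hc, hwc⟩ := this
    have := hσpos c hc
    exact intervalIntegral.integral_pos zero_lt_one hB (fun x _ => by positivity)
      ⟨c, hc, by positivity⟩
  have hparts := (hw.mul (hy.clm (Complex.conjCLE : ℂ →L[ℝ] ℂ))).congr_density
    (g₂ := fun x => lam * ((‖y x‖ ^ 2 : ℝ) : ℂ) + ((‖w x‖ ^ 2 / σ x ^ 2 : ℝ) : ℂ))
    fun x hx => by
      have e1 := Complex.mul_conj' (y x)
      have e2 := Complex.mul_conj' (w x)
      simp only [ContinuousLinearEquiv.coe_coe, Complex.conjCLE_apply, map_div₀, map_pow,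
        Complex.conj_ofReal]
      push_cast
      rw [← e1, ← e2]
      ring
  have hint := hparts.eq_add_integral 1 HasDensity.one_mem
  rw [intervalIntegral.integral_add, intervalIntegral.integral_const_mul,
    intervalIntegral.integral_ofReal, intervalIntegral.integral_ofReal] at hint
  · simp only [hy0, hy1, map_zero, mul_zero, zero_add] at hint
    refine ⟨-((∫ x in (0 : ℝ)..1, ‖w x‖ ^ 2 / σ x ^ 2) / ∫ x in (0 : ℝ)..1, ‖y x‖ ^ 2),
      neg_neg_of_pos (div_pos hBpos hApos), ?_⟩
    have hA' : ((∫ x in (0 : ℝ)..1, ‖y x‖ ^ 2 : ℝ) : ℂ) ≠ 0 := by exact_mod_cast hApos.ne'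
    rw [Complex.ofReal_neg, Complex.ofReal_div, ← neg_div, eq_div_iff hA']
    linear_combination -hint
  · refine HasDensity.intervalIntegrable_of_mem ?_ HasDensity.zero_mem HasDensity.one_mem
    exact (continuousOn_const.mul (Complex.continuous_ofReal.comp_continuousOn
      hA)).integrableOn_Icc
  · refine HasDensity.intervalIntegrable_of_mem ?_ HasDensity.zero_mem HasDensity.one_mem
    exact (Complex.continuous_ofReal.comp_continuousOn hB).integrableOn_Icc

theorem ACOn.exists_hasDensity {f : ℝ → ℂ} (hf : ACOn f 0 1) : ∃ g, HasDensity f g :=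
  hf.imp fun _ hg => ⟨hg.1, hg.2⟩

theorem HasDensity.acOn {f g : ℝ → ℂ} (hf : HasDensity f g) : ACOn f 0 1 :=
  ⟨g, hf.integrableOn, hf.eq_add_integral⟩

theorem hasDensity_of_acOn (hσpos : ∀ x ∈ Set.Icc (0 : ℝ) 1, 0 < σ x) (hy : ACOn y 0 1)
    (hw : ACOn (fun x => ((σ x : ℝ) : ℂ) ^ 2 * deriv y x) 0 1)
    (hode : ∀ᵐ x ∂(volume.restrict (Set.Ioo (0 : ℝ) 1)),
      deriv (fun x' => ((σ x' : ℝ) : ℂ) ^ 2 * deriv y x') x = lam * y x) :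
    HasDensity y (fun x => (σ x : ℂ) ^ 2 * deriv y x / (σ x : ℂ) ^ 2) ∧
      HasDensity (fun x => (σ x : ℂ) ^ 2 * deriv y x) (fun x => lam * y x) := by
  obtain ⟨g, hg⟩ := hy.exists_hasDensity
  obtain ⟨g', hg'⟩ := hw.exists_hasDensity
  rw [ae_restrict_iff' measurableSet_Ioo] at hode
  constructor
  · refine hg.congr_density_ae ?_
    filter_upwards [hg.ae_hasDerivAt] with x hx hx'
    have : (σ x : ℂ) ≠ 0 := by exact_mod_cast (hσpos x (Set.Ioo_subset_Icc_self hx')).ne'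
    rw [(hx hx').deriv]
    field_simp
  · refine hg'.congr_density_ae ?_
    filter_upwards [hg'.ae_hasDerivAt, hode] with x hx hx₁ hx'
    rw [← hx₁ hx', (hx hx').deriv]

theorem exists_eigenfunction (hσpos : ∀ x ∈ Set.Icc (0 : ℝ) 1, 0 < σ x) (h : sigmaAC σ)
    (hy : HasDensity y fun x => w x / (σ x : ℂ) ^ 2) (hw : HasDensity w fun x => lam * y x)
    (hw0 : w 0 ≠ 0) :
    ∃ u : ℝ → ℂ, Set.EqOn u y (Set.Icc 0 1) ∧ (¬ ∀ x ∈ Set.Icc (0 : ℝ) 1, u x = 0) ∧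
      ACOn u 0 1 ∧ ACOn (fun x => ((σ x : ℝ) : ℂ) ^ 2 * deriv u x) 0 1 ∧
      ∀ᵐ x ∂(volume.restrict (Set.Ioo (0 : ℝ) 1)),
        deriv (fun x' => ((σ x' : ℝ) : ℂ) ^ 2 * deriv u x') x = lam * u x := by
  obtain ⟨u, huy, hu⟩ := hy.exists_hasDerivAt (continuousOn_div_sq hσpos h hw.continuousOn)
  have hσ : ∀ x ∈ Set.Icc (0 : ℝ) 1, (σ x : ℂ) ≠ 0 := fun x hx => by
    exact_mod_cast (hσpos x hx).ne'
  have hD : HasDensity (fun x => (σ x : ℂ) ^ 2 * deriv u x) (fun x => lam * u x) :=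
    (hw.congr_left fun x hx => by
      have := hσ x hx
      simp only [(hu x hx).deriv]
      field_simp).congr_density fun x hx => by simp only [huy hx]
  refine ⟨u, huy, fun h0 => ?_, (hy.congr_left huy.symm).acOn, hD.acOn, ?_⟩
  · have h1 : HasDerivWithinAt u 0 (Set.Icc 0 1) 0 :=
      (hasDerivWithinAt_const (0 : ℝ) (Set.Icc (0 : ℝ) 1) (0 : ℂ)).congr h0
        (h0 0 HasDensity.zero_mem)
    have := (uniqueDiffOn_Icc zero_lt_one 0 HasDensity.zero_mem).eq_deriv _
      (hu 0 HasDensity.zero_mem).hasDerivWithinAt h1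
    simp [hw0, hσ 0 HasDensity.zero_mem] at this
  · rw [ae_restrict_iff' measurableSet_Ioo]
    filter_upwards [hD.ae_hasDerivAt] with x hx hx'
    exact (hx hx').deriv

end SturmLiouville

/-- `λ` is an eigenvalue of the Dirichlet Sturm–Liouville problem
`(σ² y')' = λ y`, `y(0) = y(1) = 0`, iff `λ` is a negative real number with `Δ(√(-λ)) = 0`. -/
theorem stmt_15 (σ : ℝ → ℝ)
    (hσpos : ∀ x ∈ Set.Icc (0 : ℝ) 1, 0 < σ x)
    (hσAC : sigmaAC σ)
    (hratio : IntegrableOn (fun t => deriv σ t / σ t) (Set.Ioo 0 1))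
    (lam : ℂ) :
    (∃ y : ℝ → ℂ,
      (¬ ∀ x ∈ Set.Icc (0 : ℝ) 1, y x = 0) ∧
      ACOn y 0 1 ∧
      ACOn (fun x => ((σ x : ℝ) : ℂ) ^ 2 * deriv y x) 0 1 ∧
      (∀ᵐ x ∂(volume.restrict (Set.Ioo (0 : ℝ) 1)),
        deriv (fun x' => ((σ x' : ℝ) : ℂ) ^ 2 * deriv y x') x = lam * y x) ∧
      y 0 = 0 ∧ y 1 = 0) ↔
    (∃ μ : ℝ, μ < 0 ∧ lam = (μ : ℂ) ∧ Δfun σ ((Real.sqrt (-μ) : ℝ) : ℂ) = 0) := by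
  rw [← integrableOn_Icc_iff_integrableOn_Ioo] at hratio
  have hk {μ : ℝ} (hμ : μ < 0) : √(-μ) ≠ 0 := (Real.sqrt_pos.2 (neg_pos.2 hμ)).ne'
  have hsq {μ : ℝ} (hμ : μ < 0) : -((√(-μ) : ℝ) : ℂ) ^ 2 = μ := by
    rw [← Complex.ofReal_pow, Real.sq_sqrt (neg_pos.2 hμ).le]
    simp
  constructor
  · rintro ⟨y, hne, hy, hw, hode, hy0, hy1⟩
    obtain ⟨hyd, hwd⟩ := hasDensity_of_acOn hσpos hy hw hode
    obtain ⟨μ, hμ, rfl⟩ := eigenvalue_neg hσpos hσAC hyd hwd hy0 hy1 hne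
    refine ⟨μ, hμ, rfl, ?_⟩
    obtain ⟨u, v, hu, hv, hu0, hv0, hiff⟩ := exists_real_solution hσpos hσAC hratio (hk hμ)
    rw [hsq hμ] at hv
    rw [← hiff]
    set w : ℝ → ℂ := fun x => (σ x : ℂ) ^ 2 * deriv y x with hw_def
    have hzero := solution_eq_zero (lam := μ)
      (y := fun x => y x + -(w 0 / v 0) * u x) (w := fun x => w x + -(w 0 / v 0) * v x) hσpos hσAC
      ((hyd.add (hu.const_mul (-(w 0 / v 0)))).congr_density fun x _ => by ring)
      ((hwd.add (hv.const_mul (-(w 0 / v 0)))).congr_density fun x _ => by ring)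
      (by simp [hy0, hu0]) (by field_simp; ring)
    have h1 := hzero 1 HasDensity.one_mem
    rw [hy1, zero_add, mul_eq_zero] at h1
    refine h1.resolve_left fun hc => hne fun x hx => ?_
    have := hzero x hx
    rwa [hc, zero_mul, add_zero] at this
  · rintro ⟨μ, hμ, rfl, hΔ⟩
    obtain ⟨y, w, hy, hw, hy0, hw0, hiff⟩ := exists_real_solution hσpos hσAC hratio (hk hμ)
    rw [hsq hμ] at hw
    obtain ⟨u, huy, hne, hu, hu', hode⟩ := exists_eigenfunction hσpos hσAC hy hw hw0
    exact ⟨u, hne, hu, hu', hode, (huy HasDensity.zero_mem).trans hy0,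
      (huy HasDensity.one_mem).trans (hiff.2 hΔ)⟩
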